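/- (Combes–Thomas estimate) Let G be a countable graph with all vertex degrees bounded by D, and let H = A + W be a self-adjoint Schrödinger operator on ℓ²(V(G)), where A is the adjacency operator and W is a bounded real multiplication operator. Suppose λ ∈ ℝ \ σ(H) and let δ = dist(λ, σ(H)). Then for every vertex x and every n ∈ ℕ, the sum over vertices y at graph distance exactly n from x of |⟨δ_y, (H-λ)^{-1} δ_x⟩|² is at most (4/δ²)·(1 + δ/(2D))^{-2n}. -/

import Mathlib

/-- The resolvent of a selfadjoint element at `z` has norm at most the inverse of the distance of `z`
to the spectrum. -/
theorem IsSelfAdjoint.infDist_mul_norm_ringInverse_le {A : Type*} [CStarAlgebra A] [Nontrivial A]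
    {a : A} (ha : IsSelfAdjoint a) {r : ℝ} (hr : (r : ℂ) ∉ spectrum ℂ a) :
    Metric.infDist (r : ℂ) (spectrum ℂ a) * ‖Ring.inverse (a - (r : ℂ) • 1)‖ ≤ 1 := by
  have hu : IsUnit (a - (r : ℂ) • 1) := by
    rw [spectrum.notMem_iff, Algebra.algebraMap_eq_smul_one] at hr
    simpa using hr.neg
  have hsa : IsSelfAdjoint (a - (r : ℂ) • 1) := by
    refine ha.sub ?_
    simp [isSelfAdjoint_iff]
  obtain ⟨u, hu⟩ := hu
  have hinv : Ring.inverse (a - (r : ℂ) • 1) = ↑u⁻¹ := by rw [← hu, Ring.inverse_unit]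
  have hsi : IsSelfAdjoint (↑u⁻¹ : A) := hinv ▸ hsa.ringInverse
  obtain ⟨k, hk, hkn⟩ := spectrum.exists_nnnorm_eq_spectralRadius (↑u⁻¹ : A)
  rw [hsi.spectralRadius_eq_nnnorm, ENNReal.coe_inj] at hkn
  have hkn : ‖k‖ = ‖(↑u⁻¹ : A)‖ := congrArg NNReal.toReal hkn
  have hk0 : k ≠ 0 := spectrum.ne_zero_of_mem_of_unit hk
  have hk' : k⁻¹ + r ∈ spectrum ℂ a := by
    have h : k⁻¹ ∈ spectrum ℂ (u : A) := spectrum.inv₀_mem_iff.mpr hk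
    rw [spectrum.mem_iff, hu] at h
    rw [spectrum.mem_iff]
    convert h using 2
    rw [map_add, Algebra.algebraMap_eq_smul_one (r : ℂ)]
    abel
  have hd := Metric.infDist_le_dist_of_mem (x := (r : ℂ)) hk'
  rw [dist_eq_norm, show (r : ℂ) - (k⁻¹ + r) = -k⁻¹ by ring, norm_neg, norm_inv] at hd
  rw [hinv, ← hkn]
  calc _ ≤ ‖k‖⁻¹ * ‖k‖ := by gcongr
    _ = 1 := inv_mul_cancel₀ (norm_ne_zero_iff.mpr hk0)

/-- Schur's bound for a symmetric neighbourhood relation with degrees at most `D`. -/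
theorem sum_sq_sum_nbhd_le {V : Type*} [DecidableEq V] (nbhd : V → Finset V)
    (hsymm : ∀ v w, w ∈ nbhd v ↔ v ∈ nbhd w) {D : ℕ} (hD : ∀ v, (nbhd v).card ≤ D)
    (f : V → ℝ) (S : Finset V) :
    ∑ y ∈ S, (∑ z ∈ nbhd y, f z) ^ 2 ≤ (D : ℝ) ^ 2 * ∑ z ∈ S.biUnion nbhd, f z ^ 2 := by
  have hswap : ∑ y ∈ S, ∑ z ∈ nbhd y, f z ^ 2 =
      ∑ z ∈ S.biUnion nbhd, ∑ _y ∈ S with _y ∈ nbhd z, f z ^ 2 := by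
    refine Finset.sum_comm' fun y z => ?_
    simp only [Finset.mem_filter, Finset.mem_biUnion]
    constructor
    · rintro ⟨hy, hz⟩
      exact ⟨⟨hy, (hsymm _ _).mp hz⟩, y, hy, hz⟩
    · rintro ⟨⟨hy, hz⟩, -⟩
      exact ⟨hy, (hsymm _ _).mpr hz⟩
  calc _ ≤ ∑ y ∈ S, (D : ℝ) * ∑ z ∈ nbhd y, f z ^ 2 := by
        refine Finset.sum_le_sum fun y _ => (sq_sum_le_card_mul_sum_sq).trans ?_
        gcongr
        exact hD y
    _ = D * ∑ z ∈ S.biUnion nbhd, ∑ _y ∈ S with _y ∈ nbhd z, f z ^ 2 := by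
        rw [← Finset.mul_sum, hswap]
    _ ≤ D * ∑ z ∈ S.biUnion nbhd, (D : ℝ) * f z ^ 2 := by
        gcongr with z
        rw [Finset.sum_const, nsmul_eq_mul]
        gcongr
        exact (Finset.card_le_card fun y hy => (Finset.mem_filter.mp hy).2).trans (hD z)
    _ = _ := by rw [← Finset.mul_sum]; ring

/-- The relative variation of a geometric weight `r ^ m` when `m` changes by at most one. -/
theorem abs_pow_sub_pow_le_sub_one_mul_pow {r : ℝ} (hr : 1 ≤ r) {i j : ℕ} (hij : i ≤ j + 1) (hji : j ≤ i + 1) :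
    |r ^ i - r ^ j| ≤ (r - 1) * r ^ j := by
  obtain rfl | rfl | rfl : i = j ∨ i = j + 1 ∨ j = i + 1 := by omega
  · simpa using mul_nonneg (sub_nonneg.mpr hr) (by positivity)
  · rw [pow_succ, show r ^ j * r - r ^ j = (r - 1) * r ^ j by ring, abs_of_nonneg]
    exact mul_nonneg (sub_nonneg.mpr hr) (by positivity)
  · rw [pow_succ, show r ^ i - r ^ i * r = -((r - 1) * r ^ i) by ring, abs_neg, abs_of_nonneg
      (mul_nonneg (sub_nonneg.mpr hr) (by positivity))]
    have h : 0 ≤ r ^ i := by positivity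
    nlinarith [mul_nonneg (mul_nonneg (sub_nonneg.mpr hr) h) (sub_nonneg.mpr hr)]

theorem SimpleGraph.Adj.min_dist_le {V : Type*} {G : SimpleGraph V} {y z : V} (h : G.Adj y z)
    (x : V) (n : ℕ) : min (G.dist x y) n ≤ min (G.dist x z) n + 1 := by
  have := h.symm.diff_dist_adj (u := x)
  omega

theorem lp.sum_norm_sq_le {V : Type*} (f : lp (fun _ : V => ℂ) 2) (S : Finset V) :
    ∑ y ∈ S, ‖f y‖ ^ 2 ≤ ‖f‖ ^ 2 := by
  simpa using lp.sum_rpow_le_norm_rpow (p := 2) (by norm_num) f S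

theorem lp.norm_le_of_forall_sum_sq_le {V : Type*} {f : lp (fun _ : V => ℂ) 2} {c : ℝ}
    (hc : 0 ≤ c) (h : ∀ S : Finset V, ∑ y ∈ S, ‖f y‖ ^ 2 ≤ c ^ 2) : ‖f‖ ≤ c :=
  lp.norm_le_of_forall_sum_le (p := 2) (by norm_num) hc (by simpa using h)

/-- Combes–Thomas estimate: for a Schrödinger operator `H = A + W` on `ℓ²(V(G))`
over a countable graph `G` with degrees bounded by `D`, and `λ ∉ σ(H)` at distance
`δ` from the spectrum, the sum over vertices `y` at graph distance exactly `n`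
from `x` of `|G^λ(y,x)|²` is at most `(4/δ²)(1 + δ/(2D))^{-2n}`. -/
theorem combes_thomas {V : Type*} [Countable V] [DecidableEq V] (G : SimpleGraph V)
    (nbhd : V → Finset V) (hnbhd : ∀ v w, w ∈ nbhd v ↔ G.Adj v w)
    (D : ℕ) (hD : ∀ v, (nbhd v).card ≤ D)
    (W : V → ℝ) (C : ℝ) (hW : ∀ v, |W v| ≤ C)
    (H : lp (fun _ : V => ℂ) 2 →L[ℂ] lp (fun _ : V => ℂ) 2)
    (hSA : IsSelfAdjoint H)
    (hH : ∀ (ψ : lp (fun _ : V => ℂ) 2) (x : V),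
      H ψ x = (∑ y ∈ nbhd x, ψ y) + (W x : ℂ) * ψ x)
    (lam : ℝ) (hlam : (lam : ℂ) ∉ spectrum ℂ H)
    (δ : ℝ) (hδ : δ = Metric.infDist (lam : ℂ) (spectrum ℂ H))
    (x : V) (n : ℕ) :
    ∑' y : {y : V // G.Reachable x y ∧ G.dist x y = n},
        ‖(Ring.inverse (H - (lam : ℂ) • 1) (lp.single 2 x (1 : ℂ))) y.1‖ ^ 2
      ≤ (4 / δ ^ 2) * (1 + δ / (2 * D)) ^ (-(2 * n : ℤ)) := by
  have : Nonempty V := ⟨x⟩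
  have : Nontrivial (lp (fun _ : V => ℂ) 2) := by
    refine ⟨lp.single 2 x 1, 0, fun h => ?_⟩
    have := lp.norm_single (E := fun _ : V => ℂ) (p := 2) (by norm_num) x 1
    simp [h] at this
  have hδ0 : 0 < δ := by
    rw [hδ]
    exact ((spectrum.isClosed H).notMem_iff_infDist_pos (spectrum.nonempty H)).mp hlam
  have hunit : IsUnit (H - (lam : ℂ) • 1) := by
    have h := spectrum.notMem_iff.mp hlam
    rw [Algebra.algebraMap_eq_smul_one] at h
    simpa using h.neg
  have hres : δ * ‖Ring.inverse (H - (lam : ℂ) • 1)‖ ≤ 1 :=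
    hδ ▸ hSA.infDist_mul_norm_ringInverse_le hlam
  have hbelow (v : lp (fun _ : V => ℂ) 2) : δ * ‖v‖ ≤ ‖(H - (lam : ℂ) • 1) v‖ := by
    have hv : Ring.inverse (H - (lam : ℂ) • 1) ((H - (lam : ℂ) • 1) v) = v := by
      rw [← mul_apply_eq_comp, Ring.inverse_mul_cancel _ hunit,
        one_apply_eq_self]
    calc δ * ‖v‖ = δ * ‖Ring.inverse (H - (lam : ℂ) • 1) ((H - (lam : ℂ) • 1) v)‖ := by rw [hv]
      _ ≤ δ * (‖Ring.inverse (H - (lam : ℂ) • 1)‖ * ‖(H - (lam : ℂ) • 1) v‖) := by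
        gcongr
        exact ContinuousLinearMap.le_opNorm _ _
      _ = (δ * ‖Ring.inverse (H - (lam : ℂ) • 1)‖) * ‖(H - (lam : ℂ) • 1) v‖ := by ring
      _ ≤ _ := mul_le_of_le_one_left (norm_nonneg _) hres
  set r : ℝ := 1 + δ / (2 * D) with hr
  have hr1 : 1 ≤ r := by
    rw [hr]
    exact le_add_of_nonneg_right (by positivity)
  have hDr : D * (r - 1) ≤ δ / 2 := by
    rcases Nat.eq_zero_or_pos D with h | h
    · simpa [h] using (half_pos hδ0).le
    · refine le_of_eq ?_
      rw [hr]
      field_simp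
      ring
  set u := Ring.inverse (H - (lam : ℂ) • 1) (lp.single 2 x (1 : ℂ)) with hu
  have hHu : (H - (lam : ℂ) • 1) u = lp.single 2 x (1 : ℂ) := by
    rw [hu, ← mul_apply_eq_comp, Ring.mul_inverse_cancel _ hunit,
      one_apply_eq_self]
  let m : V → ℕ := fun y => min (G.dist x y) n
  have hmem : Memℓp (fun y => ((r ^ m y : ℝ) : ℂ) * u y) 2 := by
    refine (lp.memℓp (((r ^ n : ℝ) : ℂ) • u)).mono' fun y => ?_
    rw [lp.coeFn_smul, Pi.smul_apply, smul_eq_mul, norm_mul, norm_mul, Complex.norm_real,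
      Complex.norm_real, Real.norm_of_nonneg (by positivity), Real.norm_of_nonneg (by positivity)]
    gcongr
    exact min_le_right _ _
  let v : lp (fun _ : V => ℂ) 2 := ⟨_, hmem⟩
  have hv (y : V) : v y = ((r ^ m y : ℝ) : ℂ) * u y := rfl
  have hnv (y : V) : ‖v y‖ = r ^ m y * ‖u y‖ := by
    rw [hv, norm_mul, Complex.norm_real, Real.norm_of_nonneg (by positivity)]
  have happly (ψ : lp (fun _ : V => ℂ) 2) (y : V) : ((H - (lam : ℂ) • 1) ψ) y =
      (∑ z ∈ nbhd y, ψ z) + (W y : ℂ) * ψ y - lam * ψ y := by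
    rw [sub_apply, lp.coeFn_sub, Pi.sub_apply, hH]
    rfl
  have hcomm (y : V) : ((H - (lam : ℂ) • 1) v - lp.single 2 x (1 : ℂ) : lp (fun _ : V => ℂ) 2) y =
      ∑ z ∈ nbhd y, (((r ^ m z - r ^ m y : ℝ) : ℂ) * u z) := by
    have hs : lp.single (E := fun _ : V => ℂ) 2 x (1 : ℂ) y =
        ((r ^ m y : ℝ) : ℂ) * lp.single (E := fun _ : V => ℂ) 2 x (1 : ℂ) y := by
      rcases eq_or_ne y x with rfl | h
      · simp [m]
      · simp [h]
    rw [lp.coeFn_sub, Pi.sub_apply, hs, ← hHu, happly, happly]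
    simp only [hv, Complex.ofReal_sub, sub_mul, Finset.sum_sub_distrib, ← Finset.mul_sum]
    ring
  have hcomm_norm : ‖(H - (lam : ℂ) • 1) v - lp.single 2 x (1 : ℂ)‖ ≤ δ / 2 * ‖v‖ := by
    refine le_trans ?_ (mul_le_mul_of_nonneg_right hDr (norm_nonneg v))
    have hr0 : 0 ≤ r - 1 := sub_nonneg.mpr hr1
    refine lp.norm_le_of_forall_sum_sq_le (by positivity) fun S => ?_
    calc _ ≤ ∑ y ∈ S, ((r - 1) * ∑ z ∈ nbhd y, ‖v z‖) ^ 2 := by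
          gcongr with y
          rw [hcomm, Finset.mul_sum]
          refine norm_sum_le_of_le _ fun z hz => ?_
          have hyz := (hnbhd y z).mp hz
          rw [norm_mul, Complex.norm_real, Real.norm_eq_abs, hnv, ← mul_assoc]
          gcongr
          rw [abs_sub_comm]
          exact abs_pow_sub_pow_le_sub_one_mul_pow hr1 (hyz.min_dist_le x n)
            (hyz.symm.min_dist_le x n)
      _ = (r - 1) ^ 2 * ∑ y ∈ S, (∑ z ∈ nbhd y, ‖v z‖) ^ 2 := by
          rw [Finset.mul_sum]
          exact Finset.sum_congr rfl fun y _ => mul_pow _ _ _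
      _ ≤ (r - 1) ^ 2 * (D ^ 2 * ‖v‖ ^ 2) := by
          gcongr
          refine (sum_sq_sum_nbhd_le nbhd (fun a b => ?_) hD _ S).trans ?_
          · rw [hnbhd, hnbhd, G.adj_comm]
          · gcongr
            exact lp.sum_norm_sq_le v _
      _ = _ := by ring
  have hvn : ‖v‖ ≤ 2 / δ := by
    have h1 : ‖lp.single (E := fun _ : V => ℂ) 2 x (1 : ℂ)‖ = 1 := by
      rw [lp.norm_single (by norm_num), norm_one]
    have h2 := norm_le_insert' ((H - (lam : ℂ) • 1) v) (lp.single 2 x (1 : ℂ))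
    have h3 := hbelow v
    rw [le_div_iff₀ hδ0]
    linarith
  have hrpos : 0 < r := by linarith
  have hz : r ^ (-(2 * n : ℤ)) = ((r ^ n) ^ 2)⁻¹ := by
    rw [zpow_neg, ← pow_mul, mul_comm n 2]
    norm_cast
  rw [hz]
  refine Real.tsum_le_of_sum_le (fun _ => by positivity) fun S => ?_
  rw [← div_eq_mul_inv, le_div_iff₀ (by positivity), Finset.sum_mul]
  calc _ = ∑ y ∈ S, ‖v y.1‖ ^ 2 := by
        refine Finset.sum_congr rfl fun y _ => ?_
        rw [hnv, mul_pow, mul_comm, show m y.1 = n by simp [m, y.2.2]]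
    _ = ∑ y ∈ S.map (Function.Embedding.subtype _), ‖v y‖ ^ 2 := by simp
    _ ≤ ‖v‖ ^ 2 := lp.sum_norm_sq_le v _
    _ ≤ (2 / δ) ^ 2 := by gcongr
    _ = 4 / δ ^ 2 := by ring
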